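/- For every Young diagram λ, the normalized character on a 3-cycle satisfies Σ_3^λ = R_4^λ + R_2^λ (i.e., the Kerov polynomial K_3 equals R_4 + R_2). -/

import Mathlib

open scoped BigOperators

namespace AsympRep

/-- A fixed filling: the canonical bijection between `Fin μ.card` and the cells of `μ`. -/
noncomputable def fill (μ : YoungDiagram) : Fin μ.card ≃ {c // c ∈ μ.cells} :=
  (Fintype.equivFinOfCardEq (Fintype.card_coe _)).symm

/-- Row coordinate of the box occupied by `x` in the canonical filling. -/
noncomputable def rowOf (μ : YoungDiagram) (x : Fin μ.card) : ℕ := (fill μ x).1.1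

/-- Column coordinate of the box occupied by `x` in the canonical filling. -/
noncomputable def colOf (μ : YoungDiagram) (x : Fin μ.card) : ℕ := (fill μ x).1.2

/-- The Young symmetrizer `c_μ = a_μ * b_μ` in the group algebra `ℚ[S_n]`, `n = |μ|`,
where `a_μ` is the sum of the row-preserving permutations and `b_μ` is the signed sum
of the column-preserving permutations (for the canonical filling of `μ`). -/
noncomputable def youngSymmetrizer (μ : YoungDiagram) :
    MonoidAlgebra ℚ (Equiv.Perm (Fin μ.card)) :=
  (∑ g : Equiv.Perm (Fin μ.card),
      if ∀ x, rowOf μ (g x) = rowOf μ x then MonoidAlgebra.single g (1 : ℚ) else 0) *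
  (∑ g : Equiv.Perm (Fin μ.card),
      if ∀ x, colOf μ (g x) = colOf μ x
      then MonoidAlgebra.single g ((Equiv.Perm.sign g : ℤ) : ℚ) else 0)

/-- The Specht module: the left ideal `ℚ[S_n]·c_μ`, realizing the irreducible
representation `ρ^μ` of `S_n` (by left multiplication). -/
noncomputable def spechtModule (μ : YoungDiagram) :
    Submodule ℚ (MonoidAlgebra ℚ (Equiv.Perm (Fin μ.card))) :=
  LinearMap.range (LinearMap.mulRight ℚ (youngSymmetrizer μ))

theorem spechtModule_invariant (μ : YoungDiagram) (π : Equiv.Perm (Fin μ.card)) :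
    ∀ x ∈ spechtModule μ,
      (LinearMap.mulLeft ℚ (MonoidAlgebra.single π (1 : ℚ))) x ∈ spechtModule μ := by
  rintro x ⟨y, rfl⟩
  exact ⟨MonoidAlgebra.single π (1 : ℚ) * y, by
    simp only [LinearMap.mulRight_apply, LinearMap.mulLeft_apply, mul_assoc]⟩

/-- The irreducible character `χ^μ(π) = Tr ρ^μ(π)` of the symmetric group `S_n`,
`n = |μ|`, computed as the trace of left multiplication by `π` on the Specht module. -/
noncomputable def irrChar (μ : YoungDiagram) (π : Equiv.Perm (Fin μ.card)) : ℚ :=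
  LinearMap.trace ℚ (spechtModule μ)
    ((LinearMap.mulLeft ℚ (MonoidAlgebra.single π (1 : ℚ))).restrict
      (spechtModule_invariant μ π))

/-- The normalized character
`Σ_π^μ = n(n-1)⋯(n-k+1) · Tr ρ^μ(π) / Tr ρ^μ(e)` for `π ∈ S_k`, where `π` is regarded
as a permutation of `{1,…,n}` acting as the identity on `{k+1,…,n}`; it is `0` if `k > n`. -/
noncomputable def normChar {k : ℕ} (μ : YoungDiagram) (π : Equiv.Perm (Fin k)) : ℚ :=
  if h : k ≤ μ.card then
    (μ.card.descFactorial k : ℚ)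
      * irrChar μ (π.viaEmbedding (Fin.castLEEmb h)) / irrChar μ 1
  else 0

/-- `Σ_m^μ`: the normalized character on the `m`-cycle `(1,2,…,m) ∈ S_m`. -/
noncomputable def SigmaCycle (μ : YoungDiagram) (m : ℕ) : ℚ := normChar μ (finRotate m)

/-- The dilation `sμ` of a Young diagram: every box is replaced by an `s × s` grid
of boxes. -/
def dilate (μ : YoungDiagram) (s : ℕ) : YoungDiagram where
  cells := (Finset.range (s * μ.colLen 0) ×ˢ Finset.range (s * μ.rowLen 0)).filter
      (fun c => (c.1 / s, c.2 / s) ∈ μ.cells)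
  isLowerSet := by
    intro a b hba h
    simp only [Finset.coe_filter, Set.mem_setOf_eq, Finset.mem_product,
      Finset.mem_range] at h ⊢
    exact ⟨⟨lt_of_le_of_lt hba.1 h.1.1, lt_of_le_of_lt hba.2 h.1.2⟩,
      μ.isLowerSet (Prod.mk_le_mk.mpr
        ⟨Nat.div_le_div_right hba.1, Nat.div_le_div_right hba.2⟩) h.2⟩

open scoped Classical in
/-- The `k`-th free cumulant `R_k^μ`: the coefficient of `s^k` in the polynomial
`s ↦ Σ_{k-1}^{sμ}`. -/
noncomputable def freeCumulant (μ : YoungDiagram) (k : ℕ) : ℚ :=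
  if h : ∃ p : Polynomial ℚ, ∀ s : ℕ, 0 < s →
      SigmaCycle (dilate μ s) (k - 1) = Polynomial.eval (s : ℚ) p
  then h.choose.coeff k else 0

/-- `N^μ(σ₁,σ₂)`: the number of colorings of the cycles of `σ₁` (by column numbers)
and of the cycles of `σ₂` (by row numbers) compatible with `μ`.  A coloring of the
cycles is encoded as a pair of functions on points constant on the respective cycles;
compatibility means that for every point `a` the box in column `h₁(a)` and row `h₂(a)`
belongs to `μ` (two cycles intersect precisely when they share a point). -/
noncomputable def Ncolorings {k : ℕ} (μ : YoungDiagram) (σ₁ σ₂ : Equiv.Perm (Fin k)) : ℕ :=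
  Set.ncard {h : (Fin k → ℕ) × (Fin k → ℕ) |
    (∀ a, h.1 (σ₁ a) = h.1 a) ∧ (∀ a, h.2 (σ₂ a) = h.2 a) ∧
    ∀ a, (h.2 a, h.1 a) ∈ μ.cells }

/-- `|C(σ)|`: the number of cycles of a permutation (fixed points count as cycles),
i.e. the number of orbits. -/
noncomputable def numCycles {k : ℕ} (σ : Equiv.Perm (Fin k)) : ℕ :=
  Set.ncard {s : Set (Fin k) | ∃ a, s = {b | σ.SameCycle a b}}

/-- The region of the plane occupied by the Young diagram `μ` drawn in the French
convention (row `i` of the diagram, `0`-indexed, occupies `[0, μ_i] × [i, i+1]`). -/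
def frenchRegion (μ : YoungDiagram) : Set (ℝ × ℝ) :=
  {p | 0 ≤ p.1 ∧ 0 ≤ p.2 ∧ p.1 ≤ (μ.rowLen ⌊p.2⌋.toNat : ℝ)}

/-- The parameter `S_i^μ = (i-1) ∬_{(x,y)∈μ} (x-y)^{i-2} dx dy` (French convention). -/
noncomputable def Sparam (μ : YoungDiagram) (i : ℕ) : ℝ :=
  ((i : ℝ) - 1) * ∫ p in frenchRegion μ, (p.1 - p.2) ^ (i - 2)

/-- The profile `ω : ℝ → ℝ` of a Young diagram: the boundary of the diagram drawn in
the Russian convention, i.e. the image of the French region under the rotation by `π/4`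
composed with the dilation by `√2`, `(x, y) ↦ (x - y, x + y)`.  `ω(u)` is the largest
`v` with `(u,v)` in the rotated region, and `ω(u) = |u|` away from the diagram. -/
noncomputable def profile (μ : YoungDiagram) (u : ℝ) : ℝ :=
  max |u| (sSup {v : ℝ | ((u + v) / 2, (v - u) / 2) ∈ frenchRegion μ})

open Equiv Finset

/-! ### Row and column sums of a Young diagram -/

/-- The sum of the row-preserving permutations in the group algebra. -/
noncomputable def rowSum (μ : YoungDiagram) : MonoidAlgebra ℚ (Perm (Fin μ.card)) :=
  ∑ g : Perm (Fin μ.card),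
    if ∀ x, rowOf μ (g x) = rowOf μ x then MonoidAlgebra.single g (1 : ℚ) else 0

/-- The signed sum of the column-preserving permutations in the group algebra. -/
noncomputable def colSum (μ : YoungDiagram) : MonoidAlgebra ℚ (Perm (Fin μ.card)) :=
  ∑ g : Perm (Fin μ.card),
    if ∀ x, colOf μ (g x) = colOf μ x
    then MonoidAlgebra.single g ((Perm.sign g : ℤ) : ℚ) else 0

theorem youngSymmetrizer_eq (μ : YoungDiagram) :
    youngSymmetrizer μ = rowSum μ * colSum μ := rfl

theorem box_mem (μ : YoungDiagram) (x : Fin μ.card) : (rowOf μ x, colOf μ x) ∈ μ :=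
  (fill μ x).2

theorem box_injective {μ : YoungDiagram} {x y : Fin μ.card} (hr : rowOf μ x = rowOf μ y)
    (hc : colOf μ x = colOf μ y) : x = y :=
  (fill μ).injective (Subtype.ext (Prod.ext hr hc))

theorem exists_box {μ : YoungDiagram} {i j : ℕ} (h : (i, j) ∈ μ) :
    ∃ x, rowOf μ x = i ∧ colOf μ x = j :=
  ⟨(fill μ).symm ⟨(i, j), h⟩, by simp [rowOf], by simp [colOf]⟩

theorem rowSum_mul_swap {μ : YoungDiagram} {x y : Fin μ.card} (h : rowOf μ x = rowOf μ y) :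
    rowSum μ * MonoidAlgebra.single (swap x y) 1 = rowSum μ := by
  have hs : ∀ z, rowOf μ (swap x y z) = rowOf μ z := fun z => by
    rw [swap_apply_def]; split_ifs <;> simp_all
  rw [rowSum, sum_mul]
  refine Fintype.sum_equiv (Equiv.mulRight (swap x y)) _ _ fun g => ?_
  have : (∀ z, rowOf μ ((g * swap x y) z) = rowOf μ z) ↔ ∀ z, rowOf μ (g z) = rowOf μ z := by
    refine ⟨fun H z => ?_, fun H z => ?_⟩
    · have := H (swap x y z)
      rwa [Perm.mul_apply, swap_apply_self, hs] at this
    · rw [Perm.mul_apply, H, hs]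
  simp only [Equiv.coe_mulRight, this]
  split_ifs <;> simp [MonoidAlgebra.single_mul_single]

theorem swap_mul_colSum {μ : YoungDiagram} {x y : Fin μ.card} (hne : x ≠ y)
    (h : colOf μ x = colOf μ y) :
    MonoidAlgebra.single (swap x y) 1 * colSum μ = -colSum μ := by
  have hs : ∀ z, colOf μ (swap x y z) = colOf μ z := fun z => by
    rw [swap_apply_def]; split_ifs <;> simp_all
  rw [colSum, mul_sum, ← sum_neg_distrib]
  refine Fintype.sum_equiv (Equiv.mulLeft (swap x y)) _ _ fun g => ?_
  have : (∀ z, colOf μ ((swap x y * g) z) = colOf μ z) ↔ ∀ z, colOf μ (g z) = colOf μ z := by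
    simp only [Perm.mul_apply, hs]
  simp only [Equiv.coe_mulLeft, this]
  split_ifs <;> simp [MonoidAlgebra.single_mul_single, Perm.sign_swap hne, MonoidAlgebra.single_neg]

/-- The sandwich of a permutation between the row sum and the column sum. -/
noncomputable def sandwich (μ : YoungDiagram) (g : Perm (Fin μ.card)) :
    MonoidAlgebra ℚ (Perm (Fin μ.card)) :=
  rowSum μ * MonoidAlgebra.single g 1 * colSum μ

theorem sandwich_one (μ : YoungDiagram) : sandwich μ 1 = youngSymmetrizer μ := by
  rw [sandwich, ← MonoidAlgebra.one_def, mul_one, youngSymmetrizer_eq]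

theorem sandwich_swap_mul {μ : YoungDiagram} {x y : Fin μ.card} (h : rowOf μ x = rowOf μ y)
    (g : Perm (Fin μ.card)) : sandwich μ (swap x y * g) = sandwich μ g := by
  have : (MonoidAlgebra.single (swap x y * g) 1 : MonoidAlgebra ℚ (Perm (Fin μ.card))) =
      MonoidAlgebra.single (swap x y) 1 * MonoidAlgebra.single g 1 := by
    simp [MonoidAlgebra.single_mul_single]
  rw [sandwich, this, ← mul_assoc, rowSum_mul_swap h, sandwich]

theorem sandwich_mul_swap {μ : YoungDiagram} {x y : Fin μ.card} (hne : x ≠ y)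
    (h : colOf μ x = colOf μ y) (g : Perm (Fin μ.card)) :
    sandwich μ (g * swap x y) = -sandwich μ g := by
  have : (MonoidAlgebra.single (g * swap x y) 1 : MonoidAlgebra ℚ (Perm (Fin μ.card))) =
      MonoidAlgebra.single g 1 * MonoidAlgebra.single (swap x y) 1 := by
    simp [MonoidAlgebra.single_mul_single]
  rw [sandwich, this, mul_assoc, mul_assoc, swap_mul_colSum hne h, mul_neg, mul_neg, sandwich,
    mul_assoc]

theorem sandwich_eq_zero {μ : YoungDiagram} {u v : Fin μ.card} (hne : u ≠ v)
    (hc : colOf μ u = colOf μ v) {g : Perm (Fin μ.card)} (hr : rowOf μ (g u) = rowOf μ (g v)) :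
    sandwich μ g = 0 := by
  have h1 : swap (g u) (g v) * g = g * swap u v := by
    rw [Equiv.mul_swap_eq_swap_mul]
  have h2 := sandwich_swap_mul hr g
  rw [h1, sandwich_mul_swap hne hc] at h2
  have h3 : (2 : ℚ) • sandwich μ g = 0 := by
    rw [two_smul]; nth_rewrite 1 [← h2]; simp
  exact (smul_eq_zero.mp h3).resolve_left two_ne_zero

theorem sandwich_swap_eq_zero {μ : YoungDiagram} {x z : Fin μ.card}
    (hr : rowOf μ x ≠ rowOf μ z) (hc : colOf μ x ≠ colOf μ z) : sandwich μ (swap x z) = 0 := by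
  rcases le_total (rowOf μ x) (rowOf μ z) with hle | hle
  · obtain ⟨w, hwr, hwc⟩ := exists_box (μ.up_left_mem hle le_rfl (box_mem μ z))
    have hwx : w ≠ x := by rintro rfl; exact hc hwc
    have hwz : w ≠ z := by rintro rfl; exact hr hwr.symm
    refine sandwich_eq_zero (u := z) (v := w) hwz.symm hwc.symm ?_
    rw [swap_apply_right, swap_apply_of_ne_of_ne hwx hwz, hwr]
  · obtain ⟨w, hwr, hwc⟩ := exists_box (μ.up_left_mem hle le_rfl (box_mem μ x))
    have hwx : w ≠ x := by rintro rfl; exact hr hwr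
    have hwz : w ≠ z := by rintro rfl; exact hc hwc.symm
    refine sandwich_eq_zero (u := x) (v := w) hwx.symm hwc.symm ?_
    rw [swap_apply_left, swap_apply_of_ne_of_ne hwx hwz, hwr]

theorem swap_mul_swap_rotate {α : Type*} [DecidableEq α] {x y z : α} (hxy : x ≠ y) (hyz : y ≠ z)
    (hzx : z ≠ x) : swap x y * swap y z = swap y z * swap z x := by
  ext t
  simp only [Perm.mul_apply, swap_apply_def]
  grind

theorem sandwich_cycle_eq_zero {μ : YoungDiagram} {x y z : Fin μ.card}
    (rxy : rowOf μ x ≠ rowOf μ y) (ryz : rowOf μ y ≠ rowOf μ z) (rzx : rowOf μ z ≠ rowOf μ x)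
    (cxy : colOf μ x ≠ colOf μ y) (cyz : colOf μ y ≠ colOf μ z) (czx : colOf μ z ≠ colOf μ x) :
    sandwich μ (swap x y * swap y z) = 0 := by
  have key : ∀ {x y z : Fin μ.card}, rowOf μ x ≠ rowOf μ y → rowOf μ y ≠ rowOf μ z →
      rowOf μ z ≠ rowOf μ x → colOf μ x ≠ colOf μ y → colOf μ y ≠ colOf μ z →
      colOf μ z ≠ colOf μ x → rowOf μ y ≤ rowOf μ x →
      sandwich μ (swap x y * swap y z) = 0 := by
    intro x y z rxy ryz rzx cxy cyz czx hle
    obtain ⟨w, hwr, hwc⟩ := exists_box (μ.up_left_mem hle le_rfl (box_mem μ x))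
    have hwx : w ≠ x := by rintro rfl; exact rxy hwr
    have hwy : w ≠ y := by rintro rfl; exact cxy hwc.symm
    have hwz : w ≠ z := by rintro rfl; exact ryz hwr.symm
    have hxy : x ≠ y := by rintro rfl; exact rxy rfl
    have hxz : x ≠ z := by rintro rfl; exact rzx rfl
    refine sandwich_eq_zero (u := x) (v := w) hwx.symm hwc.symm ?_
    rw [Perm.mul_apply, Perm.mul_apply, swap_apply_of_ne_of_ne hwy hwz,
      swap_apply_of_ne_of_ne hwx hwy, swap_apply_of_ne_of_ne hxy hxz, swap_apply_left, hwr]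
  have hxy : x ≠ y := by rintro rfl; exact rxy rfl
  have hyz : y ≠ z := by rintro rfl; exact ryz rfl
  have hzx : z ≠ x := by rintro rfl; exact rzx rfl
  rcases le_total (rowOf μ y) (rowOf μ x) with h1 | h1
  · exact key rxy ryz rzx cxy cyz czx h1
  rcases le_total (rowOf μ z) (rowOf μ y) with h2 | h2
  · rw [swap_mul_swap_rotate hxy hyz hzx]
    exact key ryz rzx rxy cyz czx cxy h2
  · rw [swap_mul_swap_rotate hxy hyz hzx, swap_mul_swap_rotate hyz hzx hxy]
    exact key rzx rxy ryz czx cxy cyz (h1.trans h2)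

/-! ### Values of the sandwich on transpositions and 3-cycles -/

/-- Indicator of two distinct points lying in the same row. -/
noncomputable def sameRow (μ : YoungDiagram) (x y : Fin μ.card) : ℚ :=
  if x ≠ y ∧ rowOf μ x = rowOf μ y then 1 else 0

/-- Indicator of two distinct points lying in the same column. -/
noncomputable def sameCol (μ : YoungDiagram) (x y : Fin μ.card) : ℚ :=
  if x ≠ y ∧ colOf μ x = colOf μ y then 1 else 0

theorem sandwich_swap {μ : YoungDiagram} {x y : Fin μ.card} (hne : x ≠ y) :
    sandwich μ (swap x y) = (sameRow μ x y - sameCol μ x y) • youngSymmetrizer μ := by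
  by_cases hr : rowOf μ x = rowOf μ y
  · have hc : colOf μ x ≠ colOf μ y := fun hc => hne (box_injective hr hc)
    have := sandwich_swap_mul hr 1
    rw [mul_one, sandwich_one] at this
    simp [sameRow, sameCol, hne, hr, hc, this]
  by_cases hc : colOf μ x = colOf μ y
  · have := sandwich_mul_swap hne hc 1
    rw [one_mul, sandwich_one] at this
    simp [sameRow, sameCol, hne, hr, hc, this]
  · simp [sameRow, sameCol, hr, hc, sandwich_swap_eq_zero hr hc]

/-- The coefficient by which the 3-cycle through `x, y, z` acts in the sandwich. -/
noncomputable def cycleCoeff (μ : YoungDiagram) (x y z : Fin μ.card) : ℚ :=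
  sameRow μ x y * sameRow μ y z * (if x = z then 0 else 1)
    + sameCol μ x y * sameCol μ y z * (if x = z then 0 else 1)
    - sameRow μ x y * sameCol μ y z - sameRow μ y z * sameCol μ z x
    - sameRow μ z x * sameCol μ x y

theorem sandwich_cycle {μ : YoungDiagram} {x y z : Fin μ.card} (hxy : x ≠ y) (hyz : y ≠ z)
    (hzx : z ≠ x) :
    sandwich μ (swap x y * swap y z) = cycleCoeff μ x y z • youngSymmetrizer μ := by
  have e1 := swap_mul_swap_rotate hxy hyz hzx
  have e2 := e1.trans (swap_mul_swap_rotate hyz hzx hxy)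
  have ixy := fun h => mt (box_injective (μ := μ) (x := x) (y := y) h) hxy
  have iyz := fun h => mt (box_injective (μ := μ) (x := y) (y := z) h) hyz
  have izx := fun h => mt (box_injective (μ := μ) (x := z) (y := x) h) hzx
  by_cases rxy : rowOf μ x = rowOf μ y
  · rw [sandwich_swap_mul rxy, sandwich_swap hyz]
    congr 1
    simp only [cycleCoeff, sameRow, sameCol]
    grind
  by_cases ryz : rowOf μ y = rowOf μ z
  · rw [e1, sandwich_swap_mul ryz, sandwich_swap hzx]
    congr 1
    simp only [cycleCoeff, sameRow, sameCol]
    grind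
  by_cases rzx : rowOf μ z = rowOf μ x
  · rw [e2, sandwich_swap_mul rzx, sandwich_swap hxy]
    congr 1
    simp only [cycleCoeff, sameRow, sameCol]
    grind
  by_cases cxy : colOf μ x = colOf μ y
  · rw [e2, sandwich_mul_swap hxy cxy, sandwich_swap hzx, ← neg_smul]
    congr 1
    simp only [cycleCoeff, sameRow, sameCol]
    grind
  by_cases cyz : colOf μ y = colOf μ z
  · rw [sandwich_mul_swap hyz cyz, sandwich_swap hxy, ← neg_smul]
    congr 1
    simp only [cycleCoeff, sameRow, sameCol]
    grind
  by_cases czx : colOf μ z = colOf μ x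
  · rw [e1, sandwich_mul_swap hzx czx, sandwich_swap hyz, ← neg_smul]
    congr 1
    simp only [cycleCoeff, sameRow, sameCol]
    grind
  · rw [sandwich_cycle_eq_zero rxy ryz rzx cxy cyz czx]
    simp [cycleCoeff, sameRow, sameCol, rxy, ryz, rzx, cxy, cyz]

/-! ### Summing over triples -/

/-- The ordered triples of distinct elements of `Fin n`. -/
def distinctTriples (n : ℕ) : Finset (Fin n × Fin n × Fin n) :=
  univ.filter fun t => t.1 ≠ t.2.1 ∧ t.2.1 ≠ t.2.2 ∧ t.2.2 ≠ t.1

theorem card_distinctTriples (n : ℕ) : (distinctTriples n).card = n.descFactorial 3 := by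
  have h := Fintype.card_embedding_eq (α := Fin 3) (β := Fin n)
  rw [Fintype.card_fin, Fintype.card_fin] at h
  rw [← h, ← card_univ]
  symm
  refine card_bij (fun e _ => (e 0, e 1, e 2)) ?_ ?_ ?_
  · intro e _
    simp [distinctTriples, e.injective.eq_iff]
  · intro e _ e' _ h
    simp only [Prod.mk.injEq] at h
    ext i
    fin_cases i <;> simp [h]
  · rintro ⟨x, y, z⟩ ht
    simp only [distinctTriples, mem_filter, mem_univ, true_and] at ht
    obtain ⟨hxy, hyz, hzx⟩ := ht
    refine ⟨⟨![x, y, z], ?_⟩, mem_univ _, rfl⟩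
    intro i j
    fin_cases i <;> fin_cases j <;> simp_all [eq_comm]

theorem card_rowOf (μ : YoungDiagram) (i : ℕ) :
    (univ.filter fun x => rowOf μ x = i).card = μ.rowLen i := by
  rw [YoungDiagram.rowLen_eq_card]
  refine card_bij (fun x _ => (rowOf μ x, colOf μ x)) ?_ ?_ ?_
  · intro x hx
    simp only [mem_filter, mem_univ, true_and] at hx
    exact YoungDiagram.mem_row_iff.2 ⟨box_mem μ x, hx⟩
  · intro x _ y _ h
    exact box_injective (Prod.ext_iff.1 h).1 (Prod.ext_iff.1 h).2
  · rintro ⟨i', j⟩ h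
    obtain ⟨hmem, rfl⟩ := YoungDiagram.mem_row_iff.1 h
    obtain ⟨x, hr, hc⟩ := exists_box hmem
    exact ⟨x, by simp [hr], by simp [hr, hc]⟩

theorem card_colOf (μ : YoungDiagram) (j : ℕ) :
    (univ.filter fun x => colOf μ x = j).card = μ.colLen j := by
  rw [YoungDiagram.colLen_eq_card]
  refine card_bij (fun x _ => (rowOf μ x, colOf μ x)) ?_ ?_ ?_
  · intro x hx
    simp only [mem_filter, mem_univ, true_and] at hx
    exact YoungDiagram.mem_col_iff.2 ⟨box_mem μ x, hx⟩
  · intro x _ y _ h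
    exact box_injective (Prod.ext_iff.1 h).1 (Prod.ext_iff.1 h).2
  · rintro ⟨i, j'⟩ h
    obtain ⟨hmem, rfl⟩ := YoungDiagram.mem_col_iff.1 h
    obtain ⟨x, hr, hc⟩ := exists_box hmem
    exact ⟨x, by simp [hc], by simp [hr, hc]⟩

theorem sum_sameRow (μ : YoungDiagram) (y : Fin μ.card) :
    ∑ x, sameRow μ y x = (μ.rowLen (rowOf μ y) : ℚ) - 1 := by
  have h : ∀ x, sameRow μ y x =
      (if rowOf μ x = rowOf μ y then 1 else 0) - (if x = y then (1 : ℚ) else 0) := fun x => by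
    unfold sameRow; grind
  simp only [h, sum_sub_distrib, sum_boole, card_rowOf, filter_eq', mem_univ, if_true,
    card_singleton, Nat.cast_one]

theorem sum_sameCol (μ : YoungDiagram) (y : Fin μ.card) :
    ∑ x, sameCol μ y x = (μ.colLen (colOf μ y) : ℚ) - 1 := by
  have h : ∀ x, sameCol μ y x =
      (if colOf μ x = colOf μ y then 1 else 0) - (if x = y then (1 : ℚ) else 0) := fun x => by
    unfold sameCol; grind
  simp only [h, sum_sub_distrib, sum_boole, card_colOf, filter_eq', mem_univ, if_true,
    card_singleton, Nat.cast_one]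

theorem sameRow_comm (μ : YoungDiagram) (x y : Fin μ.card) : sameRow μ x y = sameRow μ y x := by
  simp only [sameRow, ne_comm, eq_comm]

theorem sameCol_comm (μ : YoungDiagram) (x y : Fin μ.card) : sameCol μ x y = sameCol μ y x := by
  simp only [sameCol, ne_comm, eq_comm]

theorem cycleCoeff_eq_zero {μ : YoungDiagram} {x y z : Fin μ.card}
    (h : ¬(x ≠ y ∧ y ≠ z ∧ z ≠ x)) : cycleCoeff μ x y z = 0 := by
  have hb := fun (u v : Fin μ.card) => box_injective (μ := μ) (x := u) (y := v)
  simp only [cycleCoeff, sameRow, sameCol]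
  grind

/-- A symmetric `0`-`1` kernel summed over paths of length two with distinct endpoints. -/
theorem sum_path_ne {ι : Type*} [Fintype ι] [DecidableEq ι] (f : ι → ℚ)
    (hf : ∀ i, f i * f i = f i) :
    ∑ x, ∑ z, f x * f z * (if x = z then 0 else 1) = (∑ x, f x) ^ 2 - ∑ x, f x := by
  have h : ∀ x z, f x * f z * (if x = z then 0 else 1) =
      f x * f z - (if x = z then f x else 0) := fun x z => by
    split_ifs with hxz
    · rw [← hxz, hf]; ring
    · ring
  simp only [h, sum_sub_distrib, sum_ite_eq, mem_univ, if_true]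
  rw [sq, sum_mul_sum]

/-- The sum over boxes computing the normalized character on a 3-cycle. -/
noncomputable def boxSum (μ : YoungDiagram) : ℚ :=
  ∑ c ∈ μ.cells, ((μ.rowLen c.1 : ℚ) ^ 2 + (μ.colLen c.2 : ℚ) ^ 2
    - 3 * μ.rowLen c.1 * μ.colLen c.2)

theorem sum_boxes (μ : YoungDiagram) (f : ℕ × ℕ → ℚ) :
    ∑ x : Fin μ.card, f (rowOf μ x, colOf μ x) = ∑ c ∈ μ.cells, f c := by
  rw [← sum_coe_sort μ.cells f]
  exact Fintype.sum_equiv (fill μ) _ _ fun x => rfl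

theorem sum_cycleCoeff (μ : YoungDiagram) :
    ∑ t ∈ distinctTriples μ.card, cycleCoeff μ t.1 t.2.1 t.2.2 = boxSum μ + μ.card := by
  have h0 : ∑ t ∈ distinctTriples μ.card, cycleCoeff μ t.1 t.2.1 t.2.2 =
      ∑ x, ∑ y, ∑ z, cycleCoeff μ x y z := by
    rw [distinctTriples, sum_filter_of_ne, Fintype.sum_prod_type]
    · simp only [Fintype.sum_prod_type]
    · intro t _ ht
      by_contra h
      exact ht (cycleCoeff_eq_zero h)
  have hR : ∀ x y, sameRow μ x y * sameRow μ x y = sameRow μ x y := fun x y => by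
    unfold sameRow; split_ifs <;> simp
  have hC : ∀ x y, sameCol μ x y * sameCol μ x y = sameCol μ x y := fun x y => by
    unfold sameCol; split_ifs <;> simp
  have hmix : ∀ y, ∑ x, ∑ z, sameRow μ x y * sameCol μ y z =
      ((μ.rowLen (rowOf μ y) : ℚ) - 1) * ((μ.colLen (colOf μ y) : ℚ) - 1) := fun y => by
    simp only [sameRow_comm μ _ y]
    rw [← sum_mul_sum, sum_sameRow, sum_sameCol]
  have hrow : ∀ y, ∑ x, ∑ z, sameRow μ x y * sameRow μ y z * (if x = z then 0 else 1) =
      ((μ.rowLen (rowOf μ y) : ℚ) - 1) ^ 2 - ((μ.rowLen (rowOf μ y) : ℚ) - 1) := fun y => by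
    simp only [sameRow_comm μ _ y]
    rw [sum_path_ne _ (hR y), sum_sameRow]
  have hcol : ∀ y, ∑ x, ∑ z, sameCol μ x y * sameCol μ y z * (if x = z then 0 else 1) =
      ((μ.colLen (colOf μ y) : ℚ) - 1) ^ 2 - ((μ.colLen (colOf μ y) : ℚ) - 1) := fun y => by
    simp only [sameCol_comm μ _ y]
    rw [sum_path_ne _ (hC y), sum_sameCol]
  have h1 : ∑ x, ∑ y, ∑ z, sameRow μ x y * sameRow μ y z * (if x = z then 0 else 1) =
      ∑ y, (((μ.rowLen (rowOf μ y) : ℚ) - 1) ^ 2 - ((μ.rowLen (rowOf μ y) : ℚ) - 1)) := by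
    rw [sum_comm]; exact sum_congr rfl fun y _ => hrow y
  have h2 : ∑ x, ∑ y, ∑ z, sameCol μ x y * sameCol μ y z * (if x = z then 0 else 1) =
      ∑ y, (((μ.colLen (colOf μ y) : ℚ) - 1) ^ 2 - ((μ.colLen (colOf μ y) : ℚ) - 1)) := by
    rw [sum_comm]; exact sum_congr rfl fun y _ => hcol y
  have h3 : ∑ x, ∑ y, ∑ z, sameRow μ x y * sameCol μ y z =
      ∑ y, ((μ.rowLen (rowOf μ y) : ℚ) - 1) * ((μ.colLen (colOf μ y) : ℚ) - 1) := by
    rw [sum_comm]; exact sum_congr rfl fun y _ => hmix y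
  have h4 : ∑ x, ∑ y, ∑ z, sameRow μ y z * sameCol μ z x =
      ∑ y, ((μ.rowLen (rowOf μ y) : ℚ) - 1) * ((μ.colLen (colOf μ y) : ℚ) - 1) := by
    rw [← h3, sum_comm]
    exact sum_congr rfl fun y _ => sum_comm
  have h5 : ∑ x, ∑ y, ∑ z, sameRow μ z x * sameCol μ x y =
      ∑ y, ((μ.rowLen (rowOf μ y) : ℚ) - 1) * ((μ.colLen (colOf μ y) : ℚ) - 1) := by
    rw [← sum_congr rfl fun y _ => hmix y]
    exact sum_congr rfl fun y _ => sum_comm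
  rw [h0]
  simp only [cycleCoeff, sum_sub_distrib, sum_add_distrib, h1, h2, h3, h4, h5]
  have hn : (μ.card : ℚ) = ∑ x : Fin μ.card, (1 : ℚ) := by simp
  rw [boxSum, ← sum_boxes, hn]
  simp only [← sum_sub_distrib, ← sum_add_distrib]
  exact sum_congr rfl fun y _ => by ring

/-! ### Characters -/

theorem youngSymmetrizer_ne_zero (μ : YoungDiagram) : youngSymmetrizer μ ≠ 0 := by
  intro h
  have h1 : (youngSymmetrizer μ).coeff 1 = 1 := by
    rw [youngSymmetrizer, sum_mul_sum]
    simp only [MonoidAlgebra.coeff_sum, Finsupp.finsetSum_apply]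
    rw [sum_eq_single 1, sum_eq_single 1]
    · simp [MonoidAlgebra.single_mul_single]
    · intro g _ hg
      split_ifs <;> simp [MonoidAlgebra.single_mul_single, hg]
    · simp
    · intro g _ hg
      refine sum_eq_zero fun k _ => ?_
      split_ifs with hr hc
      · rw [MonoidAlgebra.single_mul_single, MonoidAlgebra.coeff_single, Finsupp.single_apply,
          if_neg]
        intro hgk
        apply hg
        ext1 x
        have hx : g (k x) = x := by rw [← Perm.mul_apply, hgk, Perm.one_apply]
        have hkx : k x = x := box_injective (by rw [← hr (k x), hx]) (hc x)
        rw [hkx] at hx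
        exact hx
      all_goals simp
    · simp
  simp [h] at h1

/-- Left multiplication on the Specht module, as a representation. -/
noncomputable def spechtRep (μ : YoungDiagram) :
    Perm (Fin μ.card) →* Module.End ℚ (spechtModule μ) where
  toFun g := (LinearMap.mulLeft ℚ (MonoidAlgebra.single g (1 : ℚ))).restrict
    (spechtModule_invariant μ g)
  map_one' := by
    ext1 v
    apply Subtype.ext
    simp [← MonoidAlgebra.one_def]
  map_mul' g h := by
    ext1 v
    apply Subtype.ext
    simp [← mul_assoc, MonoidAlgebra.single_mul_single]

theorem irrChar_eq_trace (μ : YoungDiagram) (g : Perm (Fin μ.card)) :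
    irrChar μ g = LinearMap.trace ℚ _ (spechtRep μ g) := rfl

theorem irrChar_eq_of_isConj {μ : YoungDiagram} {g h : Perm (Fin μ.card)} (H : IsConj g h) :
    irrChar μ g = irrChar μ h := by
  obtain ⟨c, rfl⟩ := isConj_iff.1 H
  rw [irrChar_eq_trace, irrChar_eq_trace, map_mul, LinearMap.trace_mul_comm, ← map_mul]
  congr 2
  group

theorem finiteDimensional_specht (μ : YoungDiagram) :
    FiniteDimensional ℚ (spechtModule μ) := by
  have : FiniteDimensional ℚ (MonoidAlgebra ℚ (Perm (Fin μ.card))) := by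
    infer_instance
  infer_instance

theorem irrChar_one_ne_zero (μ : YoungDiagram) : irrChar μ 1 ≠ 0 := by
  have := finiteDimensional_specht μ
  rw [irrChar_eq_trace, map_one, LinearMap.trace_one, Nat.cast_ne_zero]
  have : Nontrivial (spechtModule μ) := by
    refine ⟨⟨⟨youngSymmetrizer μ, 1, by simp⟩, 0, fun h => ?_⟩⟩
    exact youngSymmetrizer_ne_zero μ (congrArg Subtype.val h)
  exact Module.finrank_pos.ne'

/-- The sum in the group algebra of the 3-cycles `swap x y * swap y z`. -/
noncomputable def cycleSum (n : ℕ) : MonoidAlgebra ℚ (Perm (Fin n)) :=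
  ∑ t ∈ distinctTriples n, MonoidAlgebra.single (swap t.1 t.2.1 * swap t.2.1 t.2.2) 1

theorem cycleSum_comm_single {n : ℕ} (g : Perm (Fin n)) (r : ℚ) :
    cycleSum n * MonoidAlgebra.single g r = MonoidAlgebra.single g r * cycleSum n := by
  rw [cycleSum, sum_mul, mul_sum]
  symm
  refine sum_equiv (Equiv.prodCongr g (Equiv.prodCongr g g)) ?_ ?_
  · simp [distinctTriples]
  · intro t _
    simp only [MonoidAlgebra.single_mul_single, mul_one, one_mul, Equiv.prodCongr_apply,
      Prod.map_fst, Prod.map_snd]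
    congr 1
    rw [← mul_assoc, mul_swap_eq_swap_mul g t.1, mul_assoc, mul_swap_eq_swap_mul g t.2.1, mul_assoc]

theorem cycleSum_comm {n : ℕ} (v : MonoidAlgebra ℚ (Perm (Fin n))) :
    cycleSum n * v = v * cycleSum n := by
  induction v using MonoidAlgebra.induction_linear with
  | zero => simp
  | add f g hf hg => rw [mul_add, add_mul, hf, hg]
  | single g r => exact cycleSum_comm_single g r

theorem cycleSum_mul_youngSymmetrizer (μ : YoungDiagram) :
    cycleSum μ.card * youngSymmetrizer μ = (boxSum μ + μ.card) • youngSymmetrizer μ := by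
  rw [youngSymmetrizer_eq, ← mul_assoc, cycleSum_comm, cycleSum, mul_sum, sum_mul,
    ← sum_cycleCoeff, sum_smul]
  refine sum_congr rfl fun t ht => ?_
  simp only [distinctTriples, mem_filter, mem_univ, true_and] at ht
  exact sandwich_cycle ht.1 ht.2.1 ht.2.2

theorem sum_irrChar (μ : YoungDiagram) :
    ∑ t ∈ distinctTriples μ.card, irrChar μ (swap t.1 t.2.1 * swap t.2.1 t.2.2) =
      (boxSum μ + μ.card) * irrChar μ 1 := by
  simp only [irrChar_eq_trace]
  rw [← map_sum, map_one, ← smul_eq_mul, ← map_smul]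
  congr 1
  ext1 ⟨v, y, hv⟩
  apply Subtype.ext
  have h : cycleSum μ.card * v = (boxSum μ + μ.card) • v := by
    rw [← hv, LinearMap.mulRight_apply, ← mul_assoc, cycleSum_comm, mul_assoc,
      cycleSum_mul_youngSymmetrizer, mul_smul_comm]
  rw [cycleSum, sum_mul] at h
  simpa [spechtRep, LinearMap.sum_apply] using h

theorem sigmaCycle_three (μ : YoungDiagram) : SigmaCycle μ 3 = boxSum μ + μ.card := by
  have hsum := sum_irrChar μ
  unfold SigmaCycle normChar
  split_ifs with h
  · rw [div_eq_iff (irrChar_one_ne_zero μ), ← hsum, ← card_distinctTriples, ← nsmul_eq_mul,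
      ← sum_const]
    refine sum_congr rfl fun t ht => ?_
    simp only [distinctTriples, mem_filter, mem_univ, true_and] at ht
    apply irrChar_eq_of_isConj
    rw [Perm.isConj_iff_cycleType_eq, swap_comm t.1,
      (Perm.isThreeCycle_swap_mul_swap_same ht.1.symm ht.2.1 ht.2.2.symm).cycleType,
      Perm.viaEmbedding]
    classical
    convert (Perm.cycleType_extendDomain _).trans (cycleType_finRotate (n := 1))
  · have h0 : distinctTriples μ.card = ∅ := by
      rw [← card_eq_zero, card_distinctTriples]
      exact Nat.descFactorial_of_lt (not_le.1 h)
    rw [h0, sum_empty] at hsum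
    exact (mul_eq_zero.1 hsum.symm).resolve_right (irrChar_one_ne_zero μ) |>.symm

theorem sigmaCycle_one (μ : YoungDiagram) : SigmaCycle μ 1 = μ.card := by
  unfold SigmaCycle normChar
  split_ifs with h
  · have h1 : (finRotate 1).viaEmbedding (Fin.castLEEmb h) = 1 := by
      rw [finRotate_one, ← Perm.viaEmbeddingHom_apply]
      exact map_one _
    rw [h1, mul_div_cancel_right₀ _ (irrChar_one_ne_zero μ), Nat.descFactorial_one]
  · have : μ.card = 0 := by omega
    simp [this]

/-! ### Dilations -/

theorem mem_dilate {μ : YoungDiagram} {s : ℕ} (hs : 0 < s) {i j : ℕ} :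
    (i, j) ∈ dilate μ s ↔ (i / s, j / s) ∈ μ := by
  rw [← YoungDiagram.mem_cells]
  simp only [dilate, mem_filter, mem_product, mem_range, YoungDiagram.mem_cells,
    and_iff_right_iff_imp]
  intro h
  rw [mul_comm s, mul_comm s, ← Nat.div_lt_iff_lt_mul hs, ← Nat.div_lt_iff_lt_mul hs,
    ← YoungDiagram.mem_iff_lt_colLen, ← YoungDiagram.mem_iff_lt_rowLen]
  exact ⟨μ.up_left_mem le_rfl (Nat.zero_le _) h, μ.up_left_mem (Nat.zero_le _) le_rfl h⟩

theorem rowLen_dilate (μ : YoungDiagram) {s : ℕ} (hs : 0 < s) (i : ℕ) :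
    (dilate μ s).rowLen i = s * μ.rowLen (i / s) := by
  refine eq_of_forall_lt_iff fun j => ?_
  rw [← YoungDiagram.mem_iff_lt_rowLen, mem_dilate hs, YoungDiagram.mem_iff_lt_rowLen,
    Nat.div_lt_iff_lt_mul hs, mul_comm]

theorem colLen_dilate (μ : YoungDiagram) {s : ℕ} (hs : 0 < s) (j : ℕ) :
    (dilate μ s).colLen j = s * μ.colLen (j / s) := by
  refine eq_of_forall_lt_iff fun i => ?_
  rw [← YoungDiagram.mem_iff_lt_colLen, mem_dilate hs, YoungDiagram.mem_iff_lt_colLen,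
    Nat.div_lt_iff_lt_mul hs, mul_comm]

theorem sum_dilate (μ : YoungDiagram) {s : ℕ} (hs : 0 < s) (f : ℕ × ℕ → ℚ) :
    ∑ c ∈ (dilate μ s).cells, f (c.1 / s, c.2 / s) = (s : ℚ) ^ 2 * ∑ c ∈ μ.cells, f c := by
  have h : ∑ c ∈ (dilate μ s).cells, f (c.1 / s, c.2 / s) =
      ∑ p ∈ μ.cells ×ˢ (range s ×ˢ range s), f p.1 := by
    refine sum_nbij' (fun c => ((c.1 / s, c.2 / s), (c.1 % s, c.2 % s)))
      (fun p => (s * p.1.1 + p.2.1, s * p.1.2 + p.2.2)) ?_ ?_ ?_ ?_ ?_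
    · rintro ⟨i, j⟩ hc
      simp only [mem_product, mem_range, Nat.mod_lt _ hs, and_self, and_true]
      exact (mem_dilate hs).1 hc
    · rintro ⟨⟨i, j⟩, p, q⟩ hc
      simp only [mem_product, mem_range] at hc
      refine (mem_dilate hs).2 ?_
      simpa [Nat.mul_add_div hs, Nat.div_eq_of_lt hc.2.1, Nat.div_eq_of_lt hc.2.2] using hc.1
    · rintro ⟨i, j⟩ _
      simp [Nat.div_add_mod]
    · rintro ⟨⟨i, j⟩, p, q⟩ hc
      simp only [mem_product, mem_range] at hc
      simp [Nat.mul_add_div hs, Nat.div_eq_of_lt hc.2.1, Nat.div_eq_of_lt hc.2.2,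
        Nat.mod_eq_of_lt hc.2.1, Nat.mod_eq_of_lt hc.2.2]
    · intro _ _; rfl
  rw [h, sum_product]
  simp only [sum_const, card_product, card_range, nsmul_eq_mul, ← mul_sum]
  push_cast
  ring

theorem card_dilate (μ : YoungDiagram) {s : ℕ} (hs : 0 < s) :
    ((dilate μ s).card : ℚ) = (s : ℚ) ^ 2 * μ.card := by
  simpa [YoungDiagram.card] using sum_dilate μ hs fun _ => 1

theorem boxSum_dilate (μ : YoungDiagram) {s : ℕ} (hs : 0 < s) :
    boxSum (dilate μ s) = (s : ℚ) ^ 4 * boxSum μ := by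
  have h := sum_dilate μ hs fun c => (s : ℚ) ^ 2 * ((μ.rowLen c.1 : ℚ) ^ 2 +
    (μ.colLen c.2 : ℚ) ^ 2 - 3 * μ.rowLen c.1 * μ.colLen c.2)
  rw [← mul_sum (s := μ.cells), ← mul_assoc, ← pow_add] at h
  rw [boxSum, boxSum, ← h]
  refine sum_congr rfl fun c _ => ?_
  rw [rowLen_dilate μ hs, colLen_dilate μ hs]
  push_cast
  ring

theorem freeCumulant_eq_coeff {μ : YoungDiagram} {k : ℕ} (q : Polynomial ℚ)
    (hq : ∀ s : ℕ, 0 < s → SigmaCycle (dilate μ s) (k - 1) = q.eval (s : ℚ)) :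
    freeCumulant μ k = q.coeff k := by
  have h : ∃ p : Polynomial ℚ, ∀ s : ℕ, 0 < s →
      SigmaCycle (dilate μ s) (k - 1) = Polynomial.eval (s : ℚ) p := ⟨q, hq⟩
  rw [freeCumulant, dif_pos h]
  congr 1
  refine Polynomial.eq_of_infinite_eval_eq _ _ ?_
  refine Set.Infinite.mono ?_ ((Set.Ioi_infinite (0 : ℕ)).image
    (f := fun s : ℕ => (s : ℚ)) Nat.cast_injective.injOn)
  rintro _ ⟨s, hs, rfl⟩
  exact (h.choose_spec s hs).symm.trans (hq s hs)

open Polynomial in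
theorem freeCumulant_two (μ : YoungDiagram) : freeCumulant μ 2 = μ.card := by
  rw [freeCumulant_eq_coeff (C (μ.card : ℚ) * X ^ 2)]
  · simp
  · intro s hs
    rw [sigmaCycle_one, card_dilate μ hs]
    simp [mul_comm]

open Polynomial in
theorem freeCumulant_four (μ : YoungDiagram) : freeCumulant μ 4 = boxSum μ := by
  rw [freeCumulant_eq_coeff (C (boxSum μ) * X ^ 4 + C (μ.card : ℚ) * X ^ 2)]
  · simp [coeff_X_pow]
  · intro s hs
    rw [sigmaCycle_three, card_dilate μ hs, boxSum_dilate μ hs]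
    simp only [eval_add, eval_mul, eval_C, eval_pow, eval_X]
    ring

/-- For every Young diagram `μ`, `Σ_3^μ = R_4^μ + R_2^μ`
(the Kerov polynomial `K_3` is `R_4 + R_2`). -/
theorem kerov_K3 (μ : YoungDiagram) :
    SigmaCycle μ 3 = freeCumulant μ 4 + freeCumulant μ 2 := by
  rw [sigmaCycle_three, freeCumulant_four, freeCumulant_two]

end AsympRep
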